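/- Let k ≥ 3 be an odd integer and let a, s be integers with s ≥ 1. Let D be the directed path on vertices x_0, x_1, …, x_k with arcs given by: for each odd j ∈ {1,…,k}, an arc from x_j to x_{j−1}, and additionally an arc from x_j to x_{j+1} whenever j ≤ k−1. Define a labeling f of the arcs by: for each even j ∈ {0,…,k−3}, f(x_j x_{j+1}) = a − (j/2)s and f(x_{j+1} x_{j+2}) = a − ((k+1)/2 + j/2)s; and f(x_{k−1} x_k) = a − ((k−1)/2)s. Then under f the vertex-sums are: s(x_0) = a; s(x_j) = (−1)^j (2a − ((k−1)/2 + j)s) for every j ∈ {1,…,k−1}; and s(x_k) = −(a − ((k−1)/2)s). -/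

import Mathlib

/-- The vertex-sum of the vertex `x_i` of the directed path `D` on `x_0, x_1, …, x_k`
whose arcs are: for each odd `j`, an arc from `x_j` to `x_{j-1}` and (if `j ≤ k - 1`)
an arc from `x_j` to `x_{j+1}`.  Thus the edge `e` joining `x_e` and `x_{e+1}`
(for `e ∈ {0, …, k-1}`) is directed towards `x_e` when `e` is even and towards
`x_{e+1}` when `e` is odd.  Given an integer labeling `f` of the edges (`f e` being the
label of the edge joining `x_e` and `x_{e+1}`), the vertex-sum of `x_i` is the sum of
the labels of arcs entering `x_i` minus the sum of the labels of arcs leaving `x_i`. -/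
def legVertexSum (k : ℕ) (f : ℕ → ℤ) (i : ℕ) : ℤ :=
  (∑ e ∈ Finset.range k,
      if (e % 2 = 0 ∧ e = i) ∨ (e % 2 = 1 ∧ e + 1 = i) then f e else 0)
  - ∑ e ∈ Finset.range k,
      if (e % 2 = 0 ∧ e + 1 = i) ∨ (e % 2 = 1 ∧ e = i) then f e else 0

theorem leg_aux (k : ℕ) (f : ℕ → ℤ) (p : ℕ) :
    (∑ e ∈ Finset.range k, if e = p then f e else 0) = if p < k then f p else 0 := by
  simp [Finset.sum_ite_eq']

theorem leg_succ (k : ℕ) (f : ℕ → ℤ) (i : ℕ) (hi : i < k) :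
    legVertexSum k f (i + 1) =
      (-1) ^ (i + 1) * (f i + if i + 1 < k then f (i + 1) else 0) := by
  have h : f i + (if i + 1 < k then f (i + 1) else 0) =
      ∑ e ∈ Finset.range k, ((if e = i then f e else 0) + if e = i + 1 then f e else 0) := by
    rw [Finset.sum_add_distrib, leg_aux, leg_aux, if_pos hi]
  rw [h, legVertexSum, ← Finset.sum_sub_distrib, Finset.mul_sum]
  apply Finset.sum_congr rfl
  intro e _
  rcases Nat.even_or_odd (i + 1) with h2 | h2
  · rw [h2.neg_one_pow]
    have := Nat.even_iff.1 h2
    split_ifs <;> first | omega | simp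
  · rw [h2.neg_one_pow]
    have := Nat.odd_iff.1 h2
    split_ifs <;> first | omega | simp

theorem leg_zero (k : ℕ) (f : ℕ → ℤ) (hk : 0 < k) : legVertexSum k f 0 = f 0 := by
  have h : f 0 = ∑ e ∈ Finset.range k, (if e = 0 then f e else 0) := by
    rw [leg_aux, if_pos hk]
  rw [h, legVertexSum, ← Finset.sum_sub_distrib]
  apply Finset.sum_congr rfl
  intro e _
  rcases Nat.eq_zero_or_pos e with h0 | h0
  · subst h0; simp
  · have : e ≠ 0 := by omega
    simp [this]

/-- Labeling pattern (I) for a leg of odd length `k ≥ 3`: for each even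
`j ∈ {0, …, k-3}`, `f(x_j x_{j+1}) = a - (j/2)s` and
`f(x_{j+1} x_{j+2}) = a - ((k+1)/2 + j/2)s`, and `f(x_{k-1} x_k) = a - ((k-1)/2)s`.
Then the vertex-sums are `s(x_0) = a`,
`s(x_j) = (-1)^j (2a - ((k-1)/2 + j)s)` for `j ∈ {1, …, k-1}`, and
`s(x_k) = -(a - ((k-1)/2)s)`. -/
theorem legVertexSum_pattern_I_odd (k : ℕ) (hk : 3 ≤ k) (hko : k % 2 = 1)
    (a s : ℤ) (hs : 1 ≤ s) (f : ℕ → ℤ)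
    (hf : ∀ j : ℕ, j % 2 = 0 → j + 3 ≤ k →
      f j = a - ((j : ℤ) / 2) * s ∧
      f (j + 1) = a - (((k : ℤ) + 1) / 2 + (j : ℤ) / 2) * s)
    (hfk : f (k - 1) = a - (((k : ℤ) - 1) / 2) * s) :
    legVertexSum k f 0 = a ∧
    (∀ j : ℕ, 1 ≤ j → j ≤ k - 1 →
      legVertexSum k f j = (-1 : ℤ) ^ j * (2 * a - (((k : ℤ) - 1) / 2 + (j : ℤ)) * s)) ∧
    legVertexSum k f k = -(a - (((k : ℤ) - 1) / 2) * s) := by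
  obtain ⟨n, rfl⟩ : ∃ n, k = 2 * n + 1 := ⟨k / 2, by omega⟩
  have e1 : (((2 * n + 1 : ℕ) : ℤ) - 1) / 2 = n := by omega
  have e2 : (((2 * n + 1 : ℕ) : ℤ) + 1) / 2 = n + 1 := by omega
  rw [e1] at hfk ⊢
  rw [e2] at hf
  have hev : ∀ m : ℕ, m ≤ n → f (2 * m) = a - m * s := by
    intro m hm
    rcases Nat.lt_or_ge m n with h | h
    · rw [(hf (2 * m) (by omega) (by omega)).1]
      have : ((2 * m : ℕ) : ℤ) / 2 = m := by omega
      rw [this]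
    · obtain rfl : m = n := by omega
      simpa using hfk
  have hod : ∀ m : ℕ, m < n → f (2 * m + 1) = a - (n + 1 + m) * s := by
    intro m hm
    rw [(hf (2 * m) (by omega) (by omega)).2]
    have : ((2 * m : ℕ) : ℤ) / 2 = m := by omega
    rw [this]
  refine ⟨?_, ?_, ?_⟩
  · rw [leg_zero _ _ (by omega)]
    simpa using hev 0 (by omega)
  · intro j h1 h2
    obtain ⟨i, rfl⟩ : ∃ i, j = i + 1 := ⟨j - 1, by omega⟩
    rw [leg_succ _ _ _ (by omega), if_pos (by omega)]
    congr 1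
    obtain ⟨m, rfl | rfl⟩ : ∃ m, i = 2 * m ∨ i = 2 * m + 1 := ⟨i / 2, by omega⟩
    · rw [hev m (by omega), hod m (by omega)]
      push_cast
      ring
    · rw [hod m (by omega), show 2 * m + 1 + 1 = 2 * (m + 1) by ring, hev (m + 1) (by omega)]
      push_cast
      ring
  · rw [leg_succ _ _ _ (by omega), if_neg (by omega), hev n le_rfl]
    rw [Odd.neg_one_pow ⟨n, rfl⟩]
    ring
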